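/- With C the Gold type code of relative dimension k as above, the number of codewords c ∈ C with DC(c) = -1 (i.e., balanced codewords together with the zero word excluded appropriately) equals 2^{mk} - 1 - Σ_{u=0}^{k-2} (-1)^u 2^{-e(u+1)^2} (2^{m(k-u)} - 2^m) Π_{j=0}^{u-1} (2^m - 2^{e(2j+1)}). -/

import Mathlib

open Finset
open scoped Classical

/-- An alternating form has even rank. -/
theorem even_finrank_add_finrank_ker_of_isAlt {F V : Type*} [Field F] [AddCommGroup V] [Module F V]
    [FiniteDimensional F V] {B : LinearMap.BilinForm F V} (hB : B.IsAlt) :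
    Even (Module.finrank F V + Module.finrank F B.ker) := by
  obtain ⟨W, hW⟩ : ∃ W, Maximal (fun W : Submodule F V => W ≤ B.orthogonal W) W := by
    have hwf : WellFounded ((· > ·) : Submodule F V → Submodule F V → Prop) := wellFounded_gt
    have hne : {W : Submodule F V | W ≤ B.orthogonal W}.Nonempty :=
      ⟨⊥, (bot_le : ⊥ ≤ B.orthogonal ⊥)⟩
    refine ⟨hwf.min _ hne, hwf.min_mem _ hne, fun U hU hle => ?_⟩
    by_contra hlt
    exact hwf.not_lt_min _ hU (lt_of_le_not_ge hle hlt)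
  have hself : ∀ x y, B x y = 0 → B y x = 0 := hB.isRefl
  have horth : B.orthogonal W = W := by
    refine le_antisymm (fun v hv => ?_) hW.prop
    have hsup : W ⊔ Submodule.span F {v} ≤ B.orthogonal (W ⊔ Submodule.span F {v}) := by
      intro x hx
      rw [LinearMap.BilinForm.mem_orthogonal_iff]
      intro y hy
      obtain ⟨w, hw, z, hz, rfl⟩ := Submodule.mem_sup.1 hx
      obtain ⟨c, rfl⟩ := Submodule.mem_span_singleton.1 hz
      obtain ⟨w', hw', z', hz', rfl⟩ := Submodule.mem_sup.1 hy
      obtain ⟨c', rfl⟩ := Submodule.mem_span_singleton.1 hz'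
      have h1 : B w' w = 0 := hW.prop hw w' hw'
      have h2 : B w' v = 0 := hv w' hw'
      have h3 : B v w = 0 := hself _ _ (hv w hw)
      have h4 : B v v = 0 := hB v
      simp [h1, h2, h3, h4]
    exact hW.le_of_ge hsup le_sup_left
      (Submodule.mem_sup_right (Submodule.mem_span_singleton_self v))
  have hker : B.ker ≤ W := by
    rw [← horth]
    intro x hx w _
    exact hself _ _ (by rw [LinearMap.mem_ker.1 hx]; rfl)
  have h := LinearMap.BilinForm.finrank_add_finrank_orthogonal' (B := B) W
  rw [horth, inf_eq_right.2 hker] at h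
  exact ⟨_, h.symm⟩

section SkewPolynomials

variable {F K : Type*} [Field F] [Field K] [Algebra F K] (σ : K ≃ₐ[F] K)

/-- If a sum of `n = |ι|` terms `v l * σ ^ j (w l)` vanishes for `n` consecutive exponents `j`,
then it vanishes for all later ones. -/
theorem sum_mul_pow_apply_eq_zero {ι : Type*} [Fintype ι] (v w : ι → K)
    (h : ∀ j < Fintype.card ι, ∑ l, v l * (σ ^ j) (w l) = 0) (j : ℕ) :
    ∑ l, v l * (σ ^ j) (w l) = 0 := by
  set M : ℕ → ι → K := fun j l => (σ ^ j) (w l) with hM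
  set W : ℕ → Submodule K (ι → K) := fun i => Submodule.span K (M '' Set.Iio i) with hWdef
  have hmono : Monotone W := fun i j hij =>
    Submodule.span_mono (Set.image_mono (Set.Iio_subset_Iio hij))
  have hmem : ∀ {i j}, i < j → M i ∈ W j := fun {i j} hij =>
    Submodule.subset_span ⟨i, hij, rfl⟩
  obtain ⟨i, hi, hMi⟩ : ∃ i ≤ Fintype.card ι, M i ∈ W i := by
    by_contra! hcon
    have hrank : ∀ i ≤ Fintype.card ι + 1, i ≤ Module.finrank K (W i) := by
      intro i
      induction i with
      | zero => simp
      | succ i ih =>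
        intro hi
        have hlt : W i < W (i + 1) := lt_of_le_of_ne (hmono (Nat.le_succ i)) fun heq =>
          hcon i (by omega) (heq ▸ hmem (Nat.lt_succ_self i))
        have := Submodule.finrank_lt_finrank_of_lt hlt
        have := ih (by omega)
        omega
    have h1 := hrank _ le_rfl
    have h2 := Submodule.finrank_le (W (Fintype.card ι + 1))
    rw [Module.finrank_fintype_fun_eq_card] at h2
    omega
  have hstep : ∀ x ∈ W i, (fun l => σ (x l)) ∈ W i := by
    intro x hx
    induction hx using Submodule.span_induction with
    | mem x hx =>
      obtain ⟨j, hj, rfl⟩ := hx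
      have : (fun l => σ (M j l)) = M (j + 1) := by
        ext l
        simp only [hM, pow_succ', AlgEquiv.mul_apply]
      rw [this]
      rcases (Nat.succ_le_of_lt hj).lt_or_eq with h | h
      · exact hmem h
      · exact (show j + 1 = i from h) ▸ hMi
    | zero =>
      convert! (W i).zero_mem using 1
      ext l
      simp
    | add x y _ _ hx hy =>
      convert! (W i).add_mem hx hy using 1
      ext l
      simp
    | smul c x _ hx =>
      convert! (W i).smul_mem (σ c) hx using 1
      ext l
      simp
  have hall : ∀ j, M j ∈ W i := by
    intro j
    induction j with
    | zero =>
      rcases Nat.eq_zero_or_pos i with rfl | h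
      · exact hMi
      · exact hmem h
    | succ j ih =>
      have : M (j + 1) = fun l => σ (M j l) := by
        ext l
        simp only [hM, pow_succ', AlgEquiv.mul_apply]
      rw [this]
      exact hstep _ ih
  have hker : W i ≤ LinearMap.ker (∑ l, v l • (LinearMap.proj l : (ι → K) →ₗ[K] K)) := by
    rw [Submodule.span_le]
    rintro _ ⟨j, hj, rfl⟩
    simpa [hM, -AlgEquiv.coe_pow] using h j (lt_of_lt_of_le hj hi)
  simpa [hM, -AlgEquiv.coe_pow] using hker (hall j)

/-- A nonzero `σ`-polynomial of degree at most `D` has at most `|Fix σ| ^ D` zeros. -/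
theorem card_zeros_skew_le [Fintype K] {q : ℕ} (hfix : #{x | σ x = x} ≤ q) (D : ℕ) :
    ∀ c : ℕ → K, (∃ j ≤ D, c j ≠ 0) →
      #{x | ∑ j ∈ range (D + 1), c j * (σ ^ j) x = 0} ≤ q ^ D := by
  induction D with
  | zero =>
    rintro c ⟨j, hj, hcj⟩
    obtain rfl : j = 0 := by omega
    refine card_le_one.2 fun x hx y hy => ?_
    simp [hcj] at hx hy
    rw [hx, hy]
  | succ D ih =>
    rintro c ⟨j, hj, hcj⟩
    by_cases htriv : ∃ x₀ ≠ 0, ∑ j ∈ range (D + 1 + 1), c j * (σ ^ j) x₀ = 0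
    swap
    · push Not at htriv
      refine (card_le_one.2 fun x hx y hy => ?_).trans (Nat.one_le_pow _ _ ?_)
      · have h0 : ∀ z, ∑ j ∈ range (D + 1 + 1), c j * (σ ^ j) z = 0 → z = 0 := fun z hz => by
          by_contra hne
          exact htriv z hne hz
        rw [h0 x (mem_filter.1 hx).2, h0 y (mem_filter.1 hy).2]
      · exact lt_of_lt_of_le (card_pos.2 ⟨0, by simp⟩) hfix
    obtain ⟨x₀, hx₀, hzero⟩ := htriv
    set b : ℕ → K := fun j => c j * (σ ^ j) x₀ with hb
    set c' : ℕ → K := fun j => ∑ i ∈ Ico (j + 1) (D + 2), b i with hc'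
    have habel : ∀ y, ∑ j ∈ range (D + 2), b j * (σ ^ j) y =
        ∑ j ∈ range (D + 1), c' j * (σ ^ j) (σ y - y) := by
      intro y
      have h1 : ∀ n, ∑ i ∈ range n, (σ ^ i) (σ y - y) = (σ ^ n) y - y := by
        intro n
        have := Finset.sum_range_sub (fun i => (σ ^ i) y) n
        simpa [pow_succ] using this
      calc ∑ j ∈ range (D + 2), b j * (σ ^ j) y
          = ∑ j ∈ range (D + 2), b j * ∑ i ∈ range j, (σ ^ i) (σ y - y) := by
            simp only [h1, mul_sub, sum_sub_distrib, ← sum_mul]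
            rw [hzero]
            simp
        _ = ∑ j ∈ range (D + 2), ∑ i ∈ range (D + 1),
              if i < j then b j * (σ ^ i) (σ y - y) else 0 := by
            refine sum_congr rfl fun j hj => ?_
            rw [← sum_filter, mul_sum]
            refine sum_congr ?_ fun _ _ => rfl
            ext i
            simp only [mem_range, mem_filter] at hj ⊢
            omega
        _ = _ := by
            rw [sum_comm]
            refine sum_congr rfl fun i hi => ?_
            rw [← sum_filter, hc', sum_mul]
            refine sum_congr ?_ fun _ _ => rfl
            ext j
            simp only [mem_range, mem_filter, mem_Ico] at hi ⊢
            omega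
    have hne : ∃ j ≤ D, c' j ≠ 0 := by
      by_contra! hcon
      have hbz : ∀ i, 1 ≤ i → i ≤ D + 1 → b i = 0 := by
        intro i h1 h2
        have hi := hcon (i - 1) (by omega)
        rw [hc'] at hi
        simp only [Nat.sub_add_cancel h1] at hi
        rw [sum_eq_sum_Ico_succ_bot (by omega)] at hi
        rcases h2.lt_or_eq with h | h
        · have := hcon i (by omega)
          simp only [hc'] at this
          rwa [this, add_zero] at hi
        · subst h
          simpa using hi
      have hb0 : b 0 = 0 := by
        rw [sum_range_succ', sum_eq_zero, zero_add] at hzero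
        · exact hzero
        · intro i hi
          exact hbz (i + 1) (by omega) (by have := mem_range.1 hi; omega)
      have : b j = 0 := by
        rcases Nat.eq_zero_or_pos j with rfl | h
        · exact hb0
        · exact hbz j h hj
      simp [hb, hcj, hx₀, -AlgEquiv.coe_pow] at this
    calc #{x | ∑ j ∈ range (D + 1 + 1), c j * (σ ^ j) x = 0}
        ≤ #{y | ∑ j ∈ range (D + 2), b j * (σ ^ j) y = 0} := by
          refine card_le_card_of_injOn (fun x => x₀⁻¹ * x) ?_ ?_
          · intro x hx
            simp only [coe_filter, mem_univ, true_and, Set.mem_ofPred_eq] at hx ⊢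
            rw [← hx]
            refine sum_congr rfl fun j _ => ?_
            rw [hb, mul_assoc, ← map_mul, mul_inv_cancel_left₀ hx₀]
          · intro x _ y _ hxy
            exact mul_left_cancel₀ (inv_ne_zero hx₀) hxy
      _ ≤ q * #{z | ∑ j ∈ range (D + 1), c' j * (σ ^ j) z = 0} := by
          refine card_le_mul_card_image_of_maps_to (f := fun y => σ y - y) ?_ q ?_
          · intro y hy
            simp only [mem_filter, mem_univ, true_and] at hy ⊢
            rw [← habel, hy]
          · intro z _
            rcases (filter (fun y => σ y - y = z)
              ({y | ∑ j ∈ range (D + 2), b j * (σ ^ j) y = 0} : Finset K)).eq_empty_or_nonempty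
              with h | ⟨y₀, hy₀⟩
            · rw [h, card_empty]
              exact Nat.zero_le _
            · refine (card_le_card_of_injOn (fun y => y - y₀) ?_ ?_).trans hfix
              · intro y hy
                have h1 := (mem_filter.1 hy).2
                have h2 := (mem_filter.1 hy₀).2
                simp only [coe_filter, mem_univ, true_and, Set.mem_ofPred_eq, map_sub]
                linear_combination h1 - h2
              · intro x _ y _ hxy
                exact sub_left_injective hxy
      _ ≤ q * q ^ D := Nat.mul_le_mul_left _ (ih c' hne)
      _ = q ^ (D + 1) := by ring

end SkewPolynomials

section GoldForms

variable {F K : Type*} [Field F] [Field K] [Algebra F K] (σ : K ≃ₐ[F] K)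

/-- The linear map `L` with `Tr (y * L x) = Tr (∑ j, a j * (y * σ ^ (j + 1) x + x * σ ^ (j + 1) y))`,
the polarization of the quadratic form `∑ j, Tr (a j * (x * σ ^ (j + 1) x))`. -/
def goldLin {r : ℕ} (a : Fin r → K) : K →ₗ[F] K :=
  ∑ j : Fin r, (LinearMap.mulLeft F (a j) ∘ₗ (σ ^ (j + 1 : ℕ)).toLinearMap +
    (σ ^ (j + 1 : ℕ)).symm.toLinearMap ∘ₗ LinearMap.mulLeft F (a j))

theorem goldLin_apply {r : ℕ} (a : Fin r → K) (x : K) :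
    goldLin σ a x =
      ∑ j : Fin r, (a j * (σ ^ (j + 1 : ℕ)) x + (σ ^ (j + 1 : ℕ)).symm (a j * x)) := by
  simp [goldLin, -AlgEquiv.coe_pow]

theorem goldLin_zero {r : ℕ} : goldLin σ (0 : Fin r → K) = 0 := by
  ext x
  simp [goldLin_apply]

/-- An additive `σ`-invariant function takes the same values at `y * goldLin σ a x` and at
the polarization of the Gold form. -/
theorem map_mul_goldLin {A : Type*} [AddCommMonoid A] (T : K →+ A) (hT : ∀ x, T (σ x) = T x)
    {r : ℕ} (a : Fin r → K) (x y : K) :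
    T (y * goldLin σ a x) =
      T (∑ j : Fin r, a j * (y * (σ ^ (j + 1 : ℕ)) x + x * (σ ^ (j + 1 : ℕ)) y)) := by
  have hpow : ∀ (n : ℕ) z, T ((σ ^ n) z) = T z := by
    intro n
    induction n with
    | zero => simp
    | succ n ih =>
      intro z
      rw [pow_succ', AlgEquiv.mul_apply, hT, ih]
  rw [goldLin_apply, mul_sum, map_sum, map_sum]
  refine sum_congr rfl fun j _ => ?_
  rw [mul_add, mul_add, map_add, map_add]
  congr 1
  · congr 1
    ring
  · rw [← hpow (j + 1 : ℕ), map_mul, AlgEquiv.apply_symm_apply]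
    congr 1
    ring

variable [Fintype K]

/-- The number of elements of the radical of a Gold form. -/
noncomputable def goldRadCard {r : ℕ} (a : Fin r → K) : ℕ := #{x | goldLin σ a x = 0}

theorem goldRadCard_zero {r : ℕ} : goldRadCard σ (0 : Fin r → K) = Fintype.card K := by
  simp [goldRadCard, goldLin_zero]

theorem goldRadCard_pos {r : ℕ} (a : Fin r → K) : 0 < goldRadCard σ a :=
  card_pos.2 ⟨0, by simp⟩

variable [Fintype F]

theorem goldRadCard_eq_pow {r : ℕ} (a : Fin r → K) :
    goldRadCard σ a = Fintype.card F ^ Module.finrank F (LinearMap.ker (goldLin σ a)) := by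
  rw [← Module.card_eq_pow_finrank, goldRadCard, Fintype.card_subtype]
  simp

theorem odd_finrank_ker_goldLin [CharP F 2] (hodd : Odd (Module.finrank F K)) {r : ℕ}
    (a : Fin r → K) : Odd (Module.finrank F (LinearMap.ker (goldLin σ a))) := by
  have halg : Algebra.IsSeparable F K := inferInstance
  let B : LinearMap.BilinForm F K := Algebra.traceForm F K ∘ₗ goldLin σ a
  have hBapp : ∀ x y, B x y = Algebra.trace F K (y * goldLin σ a x) := fun x y => by
    simp [B, mul_comm]
  have hker : B.ker = LinearMap.ker (goldLin σ a) := by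
    ext x
    simp only [LinearMap.mem_ker]
    constructor
    · intro hx
      refine (traceForm_nondegenerate F K).1 _ fun y => ?_
      rw [Algebra.traceForm_apply, mul_comm, ← hBapp, hx, LinearMap.zero_apply]
    · intro hx
      simp [B, hx]
  have halt : B.IsAlt := by
    intro x
    have := map_mul_goldLin σ (Algebra.trace F K).toAddMonoidHom
      (fun x => Algebra.trace_eq_of_algEquiv σ x) a x x
    rw [hBapp]
    refine Eq.trans this ?_
    have : CharP K 2 := charP_of_injective_algebraMap (algebraMap F K).injective 2
    simp [CharTwo.add_self_eq_zero]
  have := even_finrank_add_finrank_ker_of_isAlt halt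
  rw [hker] at this
  grind

theorem goldRadCard_le (hfix : #{x | σ x = x} ≤ Fintype.card F) {r : ℕ} (a : Fin r → K)
    (ha : a ≠ 0) : goldRadCard σ a ≤ Fintype.card F ^ (2 * r) := by
  set b : ℕ → K := fun n => if h : n < r then a ⟨n, h⟩ else 0 with hb
  set c : ℕ → K := fun i => if i < r then (σ ^ i) (b (r - 1 - i)) else
    if i = r then 0 else (σ ^ r) (b (i - (r + 1))) with hc
  have hsum : ∀ x, ∑ i ∈ range (2 * r + 1), c i * (σ ^ i) x = (σ ^ r) (goldLin σ a x) := by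
    intro x
    have h1 : ∀ j < r, (σ ^ r) (b j * (σ ^ (j + 1)) x + (σ ^ (j + 1)).symm (b j * x)) =
        c (r + 1 + j) * (σ ^ (r + 1 + j)) x + c (r - 1 - j) * (σ ^ (r - 1 - j)) x := by
      intro j hj
      have e1 : c (r + 1 + j) = (σ ^ r) (b j) := by
        simp only [hc]
        rw [if_neg (by omega), if_neg (by omega)]
        congr 2
        omega
      have e2 : c (r - 1 - j) = (σ ^ (r - 1 - j)) (b j) := by
        simp only [hc]
        rw [if_pos (by omega)]
        congr 2
        omega
      have e3 : ∀ z, (σ ^ r) ((σ ^ (j + 1)).symm z) = (σ ^ (r - 1 - j)) z := by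
        intro z
        obtain ⟨z, rfl⟩ := (σ ^ (j + 1)).surjective z
        rw [AlgEquiv.symm_apply_apply, ← AlgEquiv.mul_apply, ← pow_add]
        congr 2
        omega
      rw [map_add, e3, e1, e2, map_mul, map_mul, ← AlgEquiv.mul_apply, ← pow_add]
      congr 4
      omega
    have h2 : goldLin σ a x =
        ∑ j ∈ range r, (b j * (σ ^ (j + 1)) x + (σ ^ (j + 1)).symm (b j * x)) := by
      rw [goldLin_apply, sum_range]
      simp [hb, -AlgEquiv.coe_pow]
    rw [h2, map_sum, sum_congr rfl fun j hj => h1 j (mem_range.1 hj), sum_add_distrib,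
      sum_range_reflect (fun i => c i * (σ ^ i) x) r,
      show 2 * r + 1 = (r + 1) + r by ring, sum_range_add, sum_range_succ]
    have : c r = 0 := by simp [hc]
    rw [this]
    ring
  have hne : ∃ j ≤ 2 * r, c j ≠ 0 := by
    obtain ⟨j, hj⟩ := Function.ne_iff.1 ha
    refine ⟨r + 1 + j, by omega, ?_⟩
    simp only [hc, hb]
    rw [if_neg (by omega), if_neg (by omega), dif_pos (by omega)]
    simpa [-AlgEquiv.coe_pow] using hj
  have := card_zeros_skew_le σ hfix (2 * r) c hne
  simpa [hsum, goldRadCard, -AlgEquiv.coe_pow] using this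

theorem exists_goldRadCard_eq [CharP F 2] (hodd : Odd (Module.finrank F K))
    (hfix : #{x | σ x = x} ≤ Fintype.card F) {r : ℕ} (a : Fin r → K) (ha : a ≠ 0) :
    ∃ i < r, goldRadCard σ a = Fintype.card F ^ (2 * i + 1) := by
  obtain ⟨i, hi⟩ := odd_finrank_ker_goldLin σ hodd a
  have h := goldRadCard_le σ hfix a ha
  rw [goldRadCard_eq_pow, hi] at h
  have := (Nat.pow_le_pow_iff_right Fintype.one_lt_card).1 h
  exact ⟨i, by omega, by rw [goldRadCard_eq_pow, hi]⟩

end GoldForms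

section Moments

variable {F K : Type*} [Field F] [Field K] [Algebra F K] (σ : K ≃ₐ[F] K)

/-- The pairing of `t` pairs of vectors with the `j`-th Gold alternating form. -/
def goldPairing {t : ℕ} (X : Fin t → K × K) (j : ℕ) : K :=
  ∑ i, ((X i).2 * (σ ^ j) (X i).1 + (X i).1 * (σ ^ j) (X i).2)

/-- The vanishing of the first `t` Gold pairings of `t` pairs of vectors forces the vanishing
of all of them. -/
theorem goldPairing_eq_zero_of_le [CharP K 2] {t : ℕ} (X : Fin t → K × K)
    (h : ∀ j < t, goldPairing σ X (j + 1) = 0) (j : ℕ) : goldPairing σ X (j + 1) = 0 := by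
  let v : Fin t ⊕ Fin t → K := Sum.elim (fun i => (X i).2) fun i => (X i).1
  let w : Fin t ⊕ Fin t → K :=
    Sum.elim (fun i => (σ ^ t).symm (X i).1) fun i => (σ ^ t).symm (X i).2
  have hvw : ∀ n, ∑ l, v l * (σ ^ n) (w l) =
      ∑ i, ((X i).2 * (σ ^ n) ((σ ^ t).symm (X i).1) +
        (X i).1 * (σ ^ n) ((σ ^ t).symm (X i).2)) := by
    intro n
    rw [Fintype.sum_sum_type, sum_add_distrib]
    rfl
  have hadd : ∀ n, ∑ l, v l * (σ ^ (n + t)) (w l) = goldPairing σ X n := by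
    intro n
    rw [hvw, goldPairing]
    simp only [pow_add, AlgEquiv.mul_apply, AlgEquiv.apply_symm_apply]
  have hsub : ∀ n ≤ t, (σ ^ n) (∑ l, v l * (σ ^ (t - n)) (w l)) = goldPairing σ X n := by
    intro n hn
    have : ∀ z, (σ ^ n) ((σ ^ (t - n)) ((σ ^ t).symm z)) = z := by
      intro z
      rw [← AlgEquiv.mul_apply, ← pow_add, Nat.add_sub_cancel' hn, AlgEquiv.apply_symm_apply]
    rw [hvw, goldPairing, map_sum]
    refine sum_congr rfl fun i _ => ?_
    rw [map_add, map_mul, map_mul, this, this]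
    ring
  rw [← hadd]
  refine sum_mul_pow_apply_eq_zero σ v w (fun n hn => ?_) _
  rw [Fintype.card_sum, Fintype.card_fin] at hn
  rcases lt_trichotomy n t with hlt | rfl | hgt
  · have h1 := hsub (t - n) (Nat.sub_le _ _)
    rw [Nat.sub_sub_self hlt.le, ← Nat.sub_add_cancel (show 1 ≤ t - n by omega),
      h _ (by omega)] at h1
    exact (map_eq_zero _).1 h1
  · have := hadd 0
    rw [zero_add] at this
    rw [this, goldPairing]
    simp [mul_comm, CharTwo.add_self_eq_zero]
  · obtain ⟨i, rfl⟩ := Nat.exists_eq_add_of_lt hgt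
    rw [show t + i + 1 = (i + 1) + t by ring, hadd]
    exact h i (by omega)

variable {ψ : AddChar K ℚ}

theorem AddChar.map_sum_eq_prod {A M ι : Type*} [AddCommMonoid A] [CommMonoid M]
    (φ : AddChar A M) (s : Finset ι) (f : ι → A) : φ (∑ i ∈ s, f i) = ∏ i ∈ s, φ (f i) := by
  induction s using Finset.induction_on with
  | empty => simp
  | insert i s hi ih => rw [sum_insert hi, prod_insert hi, AddChar.map_add_eq_mul, ih]

theorem AddChar.map_mul_goldLin (hσ : ∀ x, ψ (σ x) = ψ x) {r : ℕ} (a : Fin r → K) (x y : K) :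
    ψ (y * goldLin σ a x) =
      ψ (∑ j : Fin r, a j * (y * (σ ^ (j + 1 : ℕ)) x + x * (σ ^ (j + 1 : ℕ)) y)) :=
  _root_.map_mul_goldLin σ ψ.toAddMonoidHom hσ a x y

variable [Fintype K]

theorem AddChar.IsPrimitive.sum_mul (hψ : ψ.IsPrimitive) (b : K) :
    ∑ x, ψ (x * b) = if b = 0 then (Fintype.card K : ℚ) else 0 := by
  rw [AddChar.sum_mulShift b hψ]
  split_ifs <;> simp

theorem sum_char_mul_goldLin (hψ : ψ.IsPrimitive) {r : ℕ} (a : Fin r → K) :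
    ∑ z : K × K, ψ (z.2 * goldLin σ a z.1) = Fintype.card K * goldRadCard σ a := by
  rw [Fintype.sum_prod_type]
  simp only [hψ.sum_mul]
  rw [← sum_filter, sum_const, nsmul_eq_mul, mul_comm, goldRadCard]

theorem sum_goldRadCard_pow_eq (hψ : ψ.IsPrimitive) (hσ : ∀ x, ψ (σ x) = ψ x) (r t : ℕ) :
    ∑ a : Fin r → K, ((Fintype.card K : ℚ) * goldRadCard σ a) ^ t =
      Fintype.card K ^ r * #{X : Fin t → K × K | ∀ j < r, goldPairing σ X (j + 1) = 0} := by
  calc ∑ a : Fin r → K, ((Fintype.card K : ℚ) * goldRadCard σ a) ^ t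
      = ∑ a : Fin r → K, ∑ X : Fin t → K × K,
          ψ (∑ j : Fin r, a j * goldPairing σ X (j + 1)) := by
        refine sum_congr rfl fun a _ => ?_
        rw [← sum_char_mul_goldLin σ hψ, Fintype.sum_pow]
        refine sum_congr rfl fun X _ => ?_
        simp only [AddChar.map_mul_goldLin σ hσ]
        rw [← AddChar.map_sum_eq_prod, sum_comm]
        simp only [goldPairing, mul_sum]
    _ = ∑ X : Fin t → K × K, ∏ j : Fin r, ∑ y, ψ (y * goldPairing σ X (j + 1)) := by
        rw [sum_comm]
        refine sum_congr rfl fun X _ => ?_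
        rw [Fintype.prod_sum]
        simp only [AddChar.map_sum_eq_prod]
    _ = ∑ X : Fin t → K × K, if ∀ j < r, goldPairing σ X (j + 1) = 0 then
          (Fintype.card K : ℚ) ^ r else 0 := by
        refine sum_congr rfl fun X _ => ?_
        simp only [hψ.sum_mul]
        split_ifs with h
        · rw [prod_congr rfl fun (j : Fin r) _ => if_pos (h j j.2)]
          simp
        · push Not at h
          obtain ⟨j, hj, hne⟩ := h
          exact prod_eq_zero (i := (⟨j, hj⟩ : Fin r)) (mem_univ _) (if_neg hne)
    _ = _ := by rw [← sum_filter, sum_const, nsmul_eq_mul, mul_comm]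

/-- The power moments of order at most `t` of `goldRadCard` over `Fin r → K` do not depend,
up to normalization, on `r ≥ t`. -/
theorem sum_goldRadCard_pow [CharP K 2] (hψ : ψ.IsPrimitive) (hσ : ∀ x, ψ (σ x) = ψ x)
    {r t i : ℕ} (hit : i ≤ t) (htr : t ≤ r) :
    ∑ a : Fin r → K, (goldRadCard σ a : ℚ) ^ i =
      Fintype.card K ^ (r - t) * ∑ a : Fin t → K, (goldRadCard σ a : ℚ) ^ i := by
  have hK : (Fintype.card K : ℚ) ≠ 0 := by simp
  have hset : ∀ s, i ≤ s → #{X : Fin i → K × K | ∀ j < s, goldPairing σ X (j + 1) = 0} =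
      #{X : Fin i → K × K | ∀ j < i, goldPairing σ X (j + 1) = 0} := by
    intro s hs
    congr 1
    ext X
    simp only [mem_filter, mem_univ, true_and]
    exact ⟨fun h j hj => h j (by omega), fun h j _ => goldPairing_eq_zero_of_le σ X h j⟩
  have h1 := sum_goldRadCard_pow_eq σ hψ hσ r i
  have h2 := sum_goldRadCard_pow_eq σ hψ hσ t i
  rw [hset r (hit.trans htr)] at h1
  rw [hset t hit] at h2
  simp only [mul_pow, ← mul_sum] at h1 h2
  have h3 : (Fintype.card K : ℚ) ^ r = Fintype.card K ^ (r - t) * Fintype.card K ^ t := by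
    rw [← pow_add, Nat.sub_add_cancel htr]
  apply mul_left_cancel₀ (pow_ne_zero i hK)
  rw [h1, h3]
  linear_combination -(Fintype.card K : ℚ) ^ (r - t) * h2

theorem sum_eval_goldRadCard [CharP K 2] (hψ : ψ.IsPrimitive) (hσ : ∀ x, ψ (σ x) = ψ x)
    {r t : ℕ} (htr : t ≤ r) (f : Polynomial ℚ) (hf : f.natDegree ≤ t) :
    ∑ a : Fin r → K, f.eval (goldRadCard σ a : ℚ) =
      Fintype.card K ^ (r - t) * ∑ a : Fin t → K, f.eval (goldRadCard σ a : ℚ) := by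
  simp only [Polynomial.eval_eq_sum_range' (Nat.lt_succ_of_le hf)]
  rw [sum_comm, sum_comm (s := (univ : Finset (Fin t → K))), mul_sum]
  refine sum_congr rfl fun i hi => ?_
  rw [← mul_sum, ← mul_sum,
    sum_goldRadCard_pow σ hψ hσ (Nat.lt_succ_iff.1 (mem_range.1 hi)) htr]
  ring

variable [Fintype F]

theorem sum_prod_goldRadCard_sub [CharP F 2] (hodd : Odd (Module.finrank F K))
    (hfix : #{x | σ x = x} ≤ Fintype.card F) (hψ : ψ.IsPrimitive) (hσ : ∀ x, ψ (σ x) = ψ x)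
    {r u : ℕ} (hur : u ≤ r) :
    ∑ a : Fin r → K, ∏ i ∈ range u, ((goldRadCard σ a : ℚ) - Fintype.card F ^ (2 * i + 1)) =
      Fintype.card K ^ (r - u) *
        ∏ i ∈ range u, ((Fintype.card K : ℚ) - Fintype.card F ^ (2 * i + 1)) := by
  have : CharP K 2 := charP_of_injective_algebraMap (algebraMap F K).injective 2
  let f : Polynomial ℚ :=
    ∏ i ∈ range u, (Polynomial.X - Polynomial.C ((Fintype.card F : ℚ) ^ (2 * i + 1)))
  have hf : ∀ x, f.eval x = ∏ i ∈ range u, (x - (Fintype.card F : ℚ) ^ (2 * i + 1)) := by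
    intro x
    simp [f, Polynomial.eval_prod]
  have hdeg : f.natDegree ≤ u := by
    rw [Polynomial.natDegree_finsetProd_X_sub_C_eq_card, card_range]
  have h := sum_eval_goldRadCard σ hψ hσ hur f hdeg
  simp only [hf] at h
  rw [h, sum_eq_single 0, goldRadCard_zero]
  · intro a _ ha
    obtain ⟨i, hi, heq⟩ := exists_goldRadCard_eq σ hodd hfix a ha
    refine prod_eq_zero (mem_range.2 hi) ?_
    rw [heq]
    simp
  · simp

theorem inv_eq_sum_prod_sub {k : Type*} [Field k] (n : ℕ → k) (hn : ∀ i, n i ≠ 0) {r : ℕ} {x : k}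
    (hx : ∃ i < r, x = n i) :
    x⁻¹ = ∑ u ∈ range r,
      ((-1) ^ u * (∏ i ∈ range (u + 1), n i)⁻¹ * ∏ i ∈ range u, (x - n i)) := by
  obtain ⟨i, hi, hxi⟩ := hx
  have hx0 : x ≠ 0 := hxi ▸ hn i
  have key : ∀ r, x⁻¹ - ∑ u ∈ range r,
      ((-1) ^ u * (∏ i ∈ range (u + 1), n i)⁻¹ * ∏ i ∈ range u, (x - n i)) =
      x⁻¹ * (-1) ^ r * (∏ i ∈ range r, n i)⁻¹ * ∏ i ∈ range r, (x - n i) := by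
    intro r
    induction r with
    | zero => simp
    | succ r ih =>
      have hP : ∏ i ∈ range r, n i ≠ 0 := prod_ne_zero_iff.2 fun i _ => hn i
      have := hn r
      rw [sum_range_succ, ← sub_sub, ih, prod_range_succ, prod_range_succ]
      field_simp
      ring
  have h := key r
  have hzero : ∏ j ∈ range r, (x - n j) = 0 :=
    prod_eq_zero (mem_range.2 hi) (sub_eq_zero.2 hxi)
  rwa [hzero, mul_zero, sub_eq_zero] at h

theorem sum_card_div_goldRadCard [CharP F 2] (hodd : Odd (Module.finrank F K))
    (hfix : #{x | σ x = x} ≤ Fintype.card F) (hψ : ψ.IsPrimitive) (hσ : ∀ x, ψ (σ x) = ψ x)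
    (r : ℕ) :
    ∑ a : Fin r → K, (Fintype.card K : ℚ) / goldRadCard σ a =
      1 + ∑ u ∈ range r, (-1) ^ u * ((Fintype.card F : ℚ) ^ (u + 1) ^ 2)⁻¹ *
        (Fintype.card K ^ (r - u + 1) - Fintype.card K) *
          ∏ i ∈ range u, ((Fintype.card K : ℚ) - Fintype.card F ^ (2 * i + 1)) := by
  have hK : (Fintype.card K : ℚ) ≠ 0 := by simp
  have hF : (Fintype.card F : ℚ) ≠ 0 := by simp
  have hprod : ∀ u, ∏ i ∈ range (u + 1), (Fintype.card F : ℚ) ^ (2 * i + 1) =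
      Fintype.card F ^ (u + 1) ^ 2 := by
    intro u
    induction u with
    | zero => simp
    | succ u ih =>
      rw [prod_range_succ, ih, ← pow_add]
      congr 1
      ring
  rw [← add_sum_erase _ _ (mem_univ (0 : Fin r → K)), goldRadCard_zero, div_self hK]
  congr 1
  calc ∑ a ∈ univ.erase (0 : Fin r → K), (Fintype.card K : ℚ) / goldRadCard σ a
      = ∑ a ∈ univ.erase (0 : Fin r → K), ∑ u ∈ range r, Fintype.card K *
          ((-1) ^ u * ((Fintype.card F : ℚ) ^ (u + 1) ^ 2)⁻¹ *
            ∏ i ∈ range u, ((goldRadCard σ a : ℚ) - Fintype.card F ^ (2 * i + 1))) := by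
        refine sum_congr rfl fun a ha => ?_
        obtain ⟨i, hi, heq⟩ := exists_goldRadCard_eq σ hodd hfix a (ne_of_mem_erase ha)
        rw [div_eq_mul_inv, inv_eq_sum_prod_sub (fun i => (Fintype.card F : ℚ) ^ (2 * i + 1))
          (fun i => pow_ne_zero _ hF) ⟨i, hi, by rw [heq]; push_cast; rfl⟩, mul_sum]
        simp only [hprod]
    _ = _ := by
        rw [sum_comm]
        refine sum_congr rfl fun u hu => ?_
        have h := sum_prod_goldRadCard_sub σ hodd hfix hψ hσ (mem_range.1 hu).le
        rw [← add_sum_erase _ _ (mem_univ (0 : Fin r → K)), goldRadCard_zero,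
          ← eq_sub_iff_add_eq'] at h
        rw [← mul_sum, ← mul_sum, h, pow_succ]
        ring

end Moments

section ExponentialSums

variable {F K : Type*} [Field F] [Field K] [Algebra F K] (σ : K ≃ₐ[F] K)

/-- The `K`-valued lift `a 0 * x + ∑ j, a (j + 1) * (x * σ ^ (j + 1) x)` of a Gold form. -/
def goldForm {r : ℕ} (a : Fin (r + 1) → K) (x : K) : K :=
  a 0 * x + ∑ j : Fin r, a j.succ * (x * (σ ^ (j + 1 : ℕ)) x)

theorem goldForm_zero_right {r : ℕ} (a : Fin (r + 1) → K) : goldForm σ a 0 = 0 := by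
  simp [goldForm]

theorem goldForm_sub_left {r : ℕ} (a b : Fin (r + 1) → K) (x : K) :
    goldForm σ (a - b) x = goldForm σ a x - goldForm σ b x := by
  simp only [goldForm, Pi.sub_apply, sub_mul, sum_sub_distrib]
  ring

theorem goldForm_add_right {r : ℕ} (a : Fin (r + 1) → K) (x y : K) :
    goldForm σ a (x + y) = goldForm σ a x + goldForm σ a y +
      ∑ j : Fin r, Fin.tail a j * (x * (σ ^ (j + 1 : ℕ)) y + y * (σ ^ (j + 1 : ℕ)) x) := by
  have h : ∀ j : Fin r, a j.succ * ((x + y) * (σ ^ (j + 1 : ℕ)) (x + y)) =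
      a j.succ * (x * (σ ^ (j + 1 : ℕ)) x) + a j.succ * (y * (σ ^ (j + 1 : ℕ)) y) +
        Fin.tail a j * (x * (σ ^ (j + 1 : ℕ)) y + y * (σ ^ (j + 1 : ℕ)) x) := by
    intro j
    rw [map_add, Fin.tail]
    ring
  simp only [goldForm, h, sum_add_distrib]
  ring

variable {ψ : AddChar K ℚ}

theorem AddChar.map_goldForm_add (hσ : ∀ x, ψ (σ x) = ψ x) {r : ℕ} (a : Fin (r + 1) → K)
    (x y : K) : ψ (goldForm σ a (x + y)) =
      ψ (goldForm σ a x) * ψ (goldForm σ a y) * ψ (x * goldLin σ (Fin.tail a) y) := by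
  rw [goldForm_add_right, AddChar.map_add_eq_mul, AddChar.map_add_eq_mul,
    AddChar.map_mul_goldLin σ hσ]

variable [Fintype K]

/-- The exponential sum attached to a Gold form. -/
noncomputable def goldSum (ψ : AddChar K ℚ) {r : ℕ} (a : Fin (r + 1) → K) : ℚ :=
  ∑ x, ψ (goldForm σ a x)

theorem goldSum_sq_eq [CharP K 2] (hψ : ψ.IsPrimitive) (hσ : ∀ x, ψ (σ x) = ψ x) {r : ℕ}
    (a : Fin (r + 1) → K) : goldSum σ ψ a ^ 2 =
      Fintype.card K * ∑ y with goldLin σ (Fin.tail a) y = 0, ψ (goldForm σ a y) := by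
  have hsq : ∀ z, ψ z * ψ z = 1 := fun z => by
    rw [← AddChar.map_add_eq_mul, CharTwo.add_self_eq_zero, AddChar.map_zero_eq_one]
  calc goldSum σ ψ a ^ 2
      = ∑ x, ∑ y, ψ (goldForm σ a x) * ψ (goldForm σ a (x + y)) := by
        rw [sq, goldSum, sum_mul_sum]
        exact sum_congr rfl fun x _ =>
          (Equiv.sum_comp (Equiv.addLeft x) fun y => ψ (goldForm σ a x) * ψ (goldForm σ a y)).symm
    _ = ∑ y, ψ (goldForm σ a y) * ∑ x, ψ (x * goldLin σ (Fin.tail a) y) := by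
        rw [sum_comm]
        refine sum_congr rfl fun y _ => ?_
        rw [mul_sum]
        refine sum_congr rfl fun x _ => ?_
        rw [AddChar.map_goldForm_add σ hσ]
        linear_combination (ψ (goldForm σ a y) * ψ (x * goldLin σ (Fin.tail a) y)) *
          hsq (goldForm σ a x)
    _ = _ := by
        simp only [hψ.sum_mul]
        rw [mul_sum, sum_filter]
        refine sum_congr rfl fun y _ => ?_
        split_ifs <;> ring

theorem goldSum_sq_eq_zero_or [CharP K 2] (hψ : ψ.IsPrimitive) (hσ : ∀ x, ψ (σ x) = ψ x) {r : ℕ}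
    (a : Fin (r + 1) → K) : goldSum σ ψ a = 0 ∨
      goldSum σ ψ a ^ 2 = Fintype.card K * goldRadCard σ (Fin.tail a) := by
  rw [← sq_eq_zero_iff, goldSum_sq_eq σ hψ hσ]
  by_cases h : ∀ y, goldLin σ (Fin.tail a) y = 0 → ψ (goldForm σ a y) = 1
  · right
    congr 1
    rw [sum_congr rfl fun y hy => h y (mem_filter.1 hy).2, sum_const, nsmul_one, goldRadCard]
  · left
    push Not at h
    obtain ⟨z, hz, hne⟩ := h
    have hshift : ∑ y with goldLin σ (Fin.tail a) y = 0, ψ (goldForm σ a y) =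
        ψ (goldForm σ a z) * ∑ y with goldLin σ (Fin.tail a) y = 0, ψ (goldForm σ a y) := by
      rw [mul_sum]
      symm
      refine sum_equiv (Equiv.addRight z) (fun y => ?_) fun y hy => ?_
      · simp [hz]
      · rw [Equiv.coe_addRight, AddChar.map_goldForm_add σ hσ, hz, mul_zero,
          AddChar.map_zero_eq_one, mul_one, mul_comm]
    rw [mul_eq_zero]
    right
    by_contra hsum
    exact hne (mul_right_cancel₀ hsum (by rw [one_mul]; exact hshift.symm))

theorem sum_goldSum_cons_sq [CharP K 2] (hψ : ψ.IsPrimitive) {r : ℕ} (a : Fin r → K) :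
    ∑ c, goldSum σ ψ (Fin.cons c a) ^ 2 = (Fintype.card K : ℚ) ^ 2 := by
  have hform : ∀ c x, goldForm σ (Fin.cons c a : Fin (r + 1) → K) x =
      c * x + goldForm σ (Fin.cons 0 a : Fin (r + 1) → K) x := by
    intro c x
    simp [goldForm]
  have hsq : ∀ c, goldSum σ ψ (Fin.cons c a) ^ 2 =
      ∑ x, ∑ y, ψ (goldForm σ (Fin.cons 0 a : Fin (r + 1) → K) x +
        goldForm σ (Fin.cons 0 a : Fin (r + 1) → K) y) * ψ (c * (x + y)) := by
    intro c
    rw [sq, goldSum, sum_mul_sum]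
    refine sum_congr rfl fun x _ => sum_congr rfl fun y _ => ?_
    rw [hform, hform c, ← AddChar.map_add_eq_mul, ← AddChar.map_add_eq_mul]
    congr 1
    ring
  calc ∑ c, goldSum σ ψ (Fin.cons c a) ^ 2
      = ∑ x, ∑ y, ψ (goldForm σ (Fin.cons 0 a : Fin (r + 1) → K) x +
          goldForm σ (Fin.cons 0 a : Fin (r + 1) → K) y) * ∑ c, ψ (c * (x + y)) := by
        simp only [hsq, mul_sum]
        rw [sum_comm]
        exact sum_congr rfl fun x _ => sum_comm
    _ = ∑ x : K, (Fintype.card K : ℚ) := by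
        refine sum_congr rfl fun x _ => ?_
        simp only [hψ.sum_mul, CharTwo.add_eq_zero, mul_ite, mul_zero]
        rw [sum_ite_eq, if_pos (mem_univ x), CharTwo.add_self_eq_zero, AddChar.map_zero_eq_one,
          one_mul]
    _ = _ := by simp [sq]

theorem card_goldSum_cons_ne_zero [CharP K 2] (hψ : ψ.IsPrimitive) (hσ : ∀ x, ψ (σ x) = ψ x)
    {r : ℕ} (a : Fin r → K) :
    (#{c | goldSum σ ψ (Fin.cons c a) ≠ 0} : ℚ) = Fintype.card K / goldRadCard σ a := by
  have hK : (Fintype.card K : ℚ) ≠ 0 := by simp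
  have hN : (goldRadCard σ a : ℚ) ≠ 0 := by exact_mod_cast (goldRadCard_pos σ a).ne'
  have h := sum_goldSum_cons_sq σ hψ a
  have h2 : ∀ c, goldSum σ ψ (Fin.cons c a) ^ 2 =
      if goldSum σ ψ (Fin.cons c a) ≠ 0 then (Fintype.card K : ℚ) * goldRadCard σ a else 0 := by
    intro c
    split_ifs with hc
    · simpa using (goldSum_sq_eq_zero_or σ hψ hσ (Fin.cons c a : Fin (r + 1) → K)).resolve_left hc
    · rw [not_not.1 hc]
      ring
  simp only [h2] at h
  rw [← sum_filter, sum_const, nsmul_eq_mul] at h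
  rw [eq_div_iff hN]
  apply mul_left_cancel₀ hK
  linear_combination h

theorem card_goldSum_eq_zero [CharP K 2] (hψ : ψ.IsPrimitive) (hσ : ∀ x, ψ (σ x) = ψ x) (r : ℕ) :
    (#{a : Fin (r + 1) → K | goldSum σ ψ a = 0} : ℚ) =
      Fintype.card K ^ (r + 1) - ∑ a : Fin r → K, (Fintype.card K : ℚ) / goldRadCard σ a := by
  have hne : (#{a : Fin (r + 1) → K | goldSum σ ψ a ≠ 0} : ℚ) =
      ∑ a : Fin r → K, (Fintype.card K : ℚ) / goldRadCard σ a := by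
    simp only [← card_goldSum_cons_ne_zero σ hψ hσ, card_filter, Nat.cast_sum]
    rw [sum_comm, ← Fintype.sum_prod_type', ← (Fin.consEquiv fun _ => K).sum_comp]
    rfl
  have h := card_filter_add_card_filter_not (s := (univ : Finset (Fin (r + 1) → K)))
    (fun a => goldSum σ ψ a = 0)
  rw [card_univ, Fintype.card_fun, Fintype.card_fin] at h
  rw [← hne, eq_sub_iff_add_eq]
  exact_mod_cast h

variable [Fintype F]

theorem eq_zero_of_forall_char_goldForm_eq_one [CharP F 2] (hodd : Odd (Module.finrank F K))
    (hfix : #{x | σ x = x} ≤ Fintype.card F) (hψ : ψ.IsPrimitive) (hσ : ∀ x, ψ (σ x) = ψ x)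
    {r : ℕ} (hr : 2 * r < Module.finrank F K + 1) {a : Fin (r + 1) → K}
    (h : ∀ x, ψ (goldForm σ a x) = 1) : a = 0 := by
  have : CharP K 2 := charP_of_injective_algebraMap (algebraMap F K).injective 2
  have hK : (Fintype.card K : ℚ) ≠ 0 := by simp
  have hS : goldSum σ ψ a = Fintype.card K := by simp [goldSum, h]
  have htail : Fin.tail a = 0 := by
    by_contra hne
    obtain ⟨i, hi, hN⟩ := exists_goldRadCard_eq σ hodd hfix _ hne
    have hsq := (goldSum_sq_eq_zero_or σ hψ hσ a).resolve_left (hS ▸ hK)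
    rw [hS, sq] at hsq
    have hcard : Fintype.card K = goldRadCard σ (Fin.tail a) := by
      exact_mod_cast mul_left_cancel₀ hK hsq
    rw [hN, Module.card_eq_pow_finrank (K := F)] at hcard
    have := Nat.pow_right_injective (Fintype.one_lt_card (α := F)) hcard
    omega
  have h0 : a 0 = 0 := by
    have h1 := hψ.sum_mul (a 0)
    have h2 : ∀ x, ψ (x * a 0) = 1 := by
      intro x
      rw [← h x, goldForm, sum_eq_zero, add_zero, mul_comm]
      intro j _
      rw [show a j.succ = 0 from congrFun htail j, zero_mul]
    simp only [h2, sum_const, card_univ, nsmul_one] at h1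
    by_contra hne
    rw [if_neg hne] at h1
    exact hK h1
  ext j
  refine Fin.cases h0 (fun j => congrFun htail j) j

end ExponentialSums

/-- If `σ` is the `n`-th power of the Frobenius with `n` prime to the degree, then it fixes at most
`|F|` elements. -/
theorem card_fixed_frobenius_pow_le {F K : Type*} [Field F] [Field K] [Algebra F K] [Fintype F]
    [Fintype K] {n : ℕ} (hn : n.Coprime (Module.finrank F K)) :
    #{x | (FiniteField.frobeniusAlgEquivOfAlgebraic F K ^ n) x = x} ≤ Fintype.card F := by
  set φ := FiniteField.frobeniusAlgEquivOfAlgebraic F K with hφ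
  obtain ⟨l, hl⟩ := exists_pow_eq_self_of_coprime
    (FiniteField.orderOf_frobeniusAlgEquivOfAlgebraic F K ▸ hn)
  have hfix : ∀ x, (φ ^ n) x = x → x ^ Fintype.card F = x := by
    intro x hx
    have : ∀ i, ((φ ^ n) ^ i) x = x := by
      intro i
      induction i with
      | zero => simp
      | succ i ih => rw [pow_succ, AlgEquiv.mul_apply, hx, ih]
    have := this l
    rwa [hl] at this
  have hne := FiniteField.X_pow_card_sub_X_ne_zero K (Fintype.one_lt_card (α := F))
  calc #{x | (φ ^ n) x = x}
      ≤ #(Polynomial.X ^ Fintype.card F - Polynomial.X : Polynomial K).roots.toFinset := by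
        refine card_le_card fun x hx => ?_
        have := hfix x (mem_filter.1 hx).2
        simp [hne, this]
    _ ≤ _ := (Multiset.toFinset_card_le _).trans ((Polynomial.card_roots' _).trans
        (FiniteField.X_pow_card_sub_X_natDegree_eq K Fintype.one_lt_card).le)

/-- The powers of an element of order `|K| - 1` run through the nonzero elements. -/
theorem image_pow_eq_erase_zero {K : Type*} [Field K] [Fintype K] {N : ℕ}
    (hN : N + 1 = Fintype.card K) {ρ : K} (hρ : orderOf ρ = N) :
    univ.image (fun i : Fin N => ρ ^ (i : ℕ)) = univ.erase 0 := by
  have hρ0 : ρ ≠ 0 := by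
    rintro rfl
    have := Fintype.one_lt_card (α := K)
    rw [orderOf_zero] at hρ
    omega
  have hinj : Function.Injective fun i : Fin N => ρ ^ (i : ℕ) := by
    intro i j hij
    exact Fin.ext (pow_injOn_Iio_orderOf (by simp [hρ]) (by simp [hρ]) hij)
  refine eq_of_subset_of_card_le (fun x hx => ?_) ?_
  · obtain ⟨i, _, rfl⟩ := mem_image.1 hx
    exact mem_erase.2 ⟨pow_ne_zero _ hρ0, mem_univ _⟩
  · rw [card_image_of_injective _ hinj, card_erase_of_mem (mem_univ _), card_univ, card_univ,
      Fintype.card_fin]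
    omega

theorem sum_pow_add_zero {K A : Type*} [Field K] [Fintype K] [AddCommMonoid A] {N : ℕ}
    (hN : N + 1 = Fintype.card K) {ρ : K} (hρ : orderOf ρ = N) (g : K → A) :
    ∑ i : Fin N, g (ρ ^ (i : ℕ)) + g 0 = ∑ x, g x := by
  rw [← sum_erase_add _ _ (mem_univ (0 : K)), ← image_pow_eq_erase_zero hN hρ, sum_image]
  intro i _ j _ hij
  exact Fin.ext (pow_injOn_Iio_orderOf (by simp [hρ]) (by simp [hρ]) hij)

/-- The number of codewords of the Gold type code of relative dimension `k`
with DC component `-1` equals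
`2^{mk} - 1 - Σ_{u=0}^{k-2} (-1)^u 2^{-e(u+1)^2} (2^{m(k-u)} - 2^m)
Π_{j=0}^{u-1} (2^m - 2^{e(2j+1)})`. -/
theorem gold_code_balanced_count (m d e k : ℕ)
    (hm : 0 < m) (hd : 0 < d) (he : 0 < e)
    (he1 : e = Nat.gcd m d) (he2 : e = Nat.gcd m (2 * d))
    (hk1 : 2 ≤ k) (hk2 : k ≤ (m + e) / (2 * e))
    (F K : Type*) [Field F] [Field K] [Algebra F K] [Fintype F] [Fintype K]
    [Algebra (ZMod 2) F]
    (hF : Fintype.card F = 2 ^ e) (hK : Fintype.card K = 2 ^ m)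
    (π : K) (hπ : orderOf π = 2 ^ m - 1)
    (Q : (Fin k → K) → K → F)
    (hQ : ∀ a x, Q a x = ∑ j : Fin k,
      (if (j : ℕ) = 0 then Algebra.trace F K (a j * x)
       else Algebra.trace F K (a j * x ^ (2 ^ ((j : ℕ) * d) + 1))))
    (cw : (Fin k → K) → Fin (2 ^ m - 1) → ZMod 2)
    (hcw : ∀ a i, cw a i = Algebra.trace (ZMod 2) F (Q a (π⁻¹ ^ (i : ℕ))))
    (DC : (Fin (2 ^ m - 1) → ZMod 2) → ℤ)
    (hDC : ∀ c, DC c = ∑ i : Fin (2 ^ m - 1), (-1 : ℤ) ^ (c i).val) :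
    (((Finset.univ.image cw).filter (fun c => DC c = -1)).card : ℚ) =
      2 ^ (m * k) - 1 -
        ∑ u ∈ Finset.range (k - 1),
          (-1 : ℚ) ^ u * (2 : ℚ) ^ (-(e * (u + 1) ^ 2 : ℤ)) *
            (2 ^ (m * (k - u)) - 2 ^ m) *
            ∏ j ∈ Finset.range u, ((2 : ℚ) ^ m - 2 ^ (e * (2 * j + 1))) := by
  obtain ⟨r, rfl⟩ : ∃ r, k = r + 1 := ⟨k - 1, by omega⟩
  have hchar : CharP F 2 := charP_of_injective_algebraMap (algebraMap (ZMod 2) F).injective 2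
  have hcharK : CharP K 2 := charP_of_injective_algebraMap (algebraMap F K).injective 2
  set s := Module.finrank F K with hs
  have hms : m = e * s := by
    have h := Module.card_eq_pow_finrank (K := F) (V := K)
    rw [hF, hK, ← pow_mul] at h
    exact Nat.pow_right_injective le_rfl h
  obtain ⟨n, hn⟩ : e ∣ d := he1 ▸ Nat.gcd_dvd_right m d
  have hcop2 : Nat.Coprime s (2 * n) := by
    rw [hms, hn, show 2 * (e * n) = e * (2 * n) by ring, Nat.gcd_mul_left] at he2
    exact (Nat.mul_eq_left he.ne').1 he2.symm
  have hcop : n.Coprime s := (Nat.Coprime.coprime_mul_left_right hcop2).symm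
  have hodd : Odd s := Nat.coprime_two_right.1 (Nat.Coprime.coprime_mul_right_right hcop2)
  have hr : 2 * r < s + 1 := by
    have h := (Nat.le_div_iff_mul_le (by positivity)).1 hk2
    rw [hms] at h
    have : e * (2 * r + 2) ≤ e * (s + 1) := by linarith
    have := Nat.le_of_mul_le_mul_left this he
    omega
  set σ : K ≃ₐ[F] K := FiniteField.frobeniusAlgEquivOfAlgebraic F K ^ n with hσdef
  have hσpow : ∀ j x, (σ ^ j) x = x ^ 2 ^ (j * d) := by
    intro j x
    rw [hσdef, ← pow_mul, AlgEquiv.coe_pow, FiniteField.coe_frobeniusAlgEquivOfAlgebraic_iterate,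
      hF, ← pow_mul, hn]
    ring_nf
  have hfix : #{x | σ x = x} ≤ Fintype.card F := card_fixed_frobenius_pow_le hcop
  let T : K →+ ZMod 2 :=
    (Algebra.trace (ZMod 2) F).toAddMonoidHom.comp (Algebra.trace F K).toAddMonoidHom
  have hT : ∀ x, T x = Algebra.trace (ZMod 2) F (Algebra.trace F K x) := fun _ => rfl
  let ψ : AddChar K ℚ :=
    (AddChar.zmodChar 2 (show (-1 : ℚ) ^ 2 = 1 by norm_num)).compAddMonoidHom T
  have hψapp : ∀ x, ψ x = (-1) ^ (T x).val := fun x => by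
    simp [ψ, AddChar.zmodChar_apply]
  have hψσ : ∀ x, ψ (σ x) = ψ x := fun x => by
    rw [hψapp, hψapp, hT, hT, Algebra.trace_eq_of_algEquiv]
  have hψ : ψ.IsPrimitive := by
    refine AddChar.IsPrimitive.of_ne_one fun h1 => ?_
    obtain ⟨y, hy⟩ := Algebra.trace_surjective (ZMod 2) F 1
    obtain ⟨x, rfl⟩ := Algebra.trace_surjective F K y
    have := congrArg (fun f : AddChar K ℚ => f x) h1
    simp only [hψapp, hT, hy, AddChar.one_apply] at this
    norm_num [ZMod.val_one] at this
  have hQform : ∀ a x, Q a x = Algebra.trace F K (goldForm σ a x) := by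
    intro a x
    rw [hQ, Fin.sum_univ_succ, goldForm, map_add, map_sum]
    congr 1
    refine sum_congr rfl fun j _ => ?_
    rw [if_neg (by simp), hσpow, Fin.val_succ, pow_succ, mul_comm x]
  have hcwT : ∀ a i, cw a i = T (goldForm σ a (π⁻¹ ^ (i : ℕ))) := by
    intro a i
    rw [hcw, hQform, hT]
  have hN : 2 ^ m - 1 + 1 = Fintype.card K := by
    rw [hK]
    exact Nat.sub_add_cancel Nat.one_le_two_pow
  have hπ' : orderOf π⁻¹ = 2 ^ m - 1 := by
    rw [← hπ]
    exact orderOf_eq_orderOf_iff.2 fun i => by rw [inv_pow, inv_eq_one]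
  have hDCsum : ∀ a, (DC (cw a) : ℚ) + 1 = goldSum σ ψ a := by
    intro a
    rw [goldSum, ← sum_pow_add_zero hN hπ' fun x => ψ (goldForm σ a x), goldForm_zero_right,
      AddChar.map_zero_eq_one, hDC]
    push_cast
    simp only [hψapp, hcwT]
  have hinj : Function.Injective cw := by
    intro a b hab
    rw [← sub_eq_zero]
    refine eq_zero_of_forall_char_goldForm_eq_one σ hodd hfix hψ hψσ hr fun x => ?_
    have hzero : T (goldForm σ (a - b) x) = 0 := by
      by_cases hx : x = 0
      · rw [hx, goldForm_zero_right, map_zero]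
      · have hmem := mem_erase.2 ⟨hx, mem_univ x⟩
        rw [← image_pow_eq_erase_zero hN hπ'] at hmem
        obtain ⟨i, _, rfl⟩ := mem_image.1 hmem
        rw [goldForm_sub_left, map_sub, ← hcwT, ← hcwT, hab, sub_self]
    rw [hψapp, hzero]
    simp
  have himage : (Finset.univ.image cw).filter (fun c => DC c = -1) =
      ({a | goldSum σ ψ a = 0} : Finset (Fin (r + 1) → K)).image cw := by
    rw [filter_image]
    congr 1
    ext a
    simp only [mem_filter, mem_univ, true_and]
    rw [← hDCsum, ← eq_neg_iff_add_eq_zero]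
    norm_cast
  rw [himage, card_image_of_injective _ hinj, card_goldSum_eq_zero σ hψ hψσ,
    sum_card_div_goldRadCard σ hodd hfix hψ hψσ, hK, hF, ← sub_sub]
  push_cast
  congr 1
  · rw [pow_mul]
  · refine sum_congr (by simp) fun u hu => ?_
    congr 1
    · congr 1
      · congr 1
        rw [zpow_neg, ← pow_mul]
        norm_cast
      · have := mem_range.1 hu
        rw [← pow_mul]
        congr 3
        omega
    · refine prod_congr rfl fun j _ => ?_
      rw [← pow_mul]
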